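/- Let {x_1,…,x_k} be a finite subset of the Cuntz algebra O_n (n ≥ 2) and let ε > 0. Then there exists a finite convex combination α = Σ_i λ_i ad(u_i) of maps ad(u)(x) := u x u* with u_i unitaries in F_n such that ‖α(x_i) − φ_n(x_i)·1‖ < ε for all i = 1,…,k. Moreover, there exists a net (α_j) of finite convex combinations of maps ad(u), u a unitary in F_n, such that lim_j ‖α_j(x) − φ_n(x)·1‖ = 0 for every x ∈ O_n. -/

import Mathlib

open scoped ComplexOrder

/-- The word `S_μ = S_{μ₁} ⋯ S_{μ_k}` associated to a multi-index `μ`. -/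
def cuntzWord {A : Type*} [Monoid A] {n : ℕ} (S : Fin n → A) (μ : List (Fin n)) : A :=
  (μ.map S).prod

/-- `F_n^k`: the C*-subalgebra generated by the words `S_μ S_ν*` with `|μ| = |ν| = k`. -/
def cuntzFnk {A : Type*} [CStarAlgebra A] {n : ℕ} (S : Fin n → A) (k : ℕ) :
    StarSubalgebra ℂ A :=
  (StarAlgebra.adjoin ℂ {x : A | ∃ μ ν : List (Fin n),
    μ.length = k ∧ ν.length = k ∧ x = cuntzWord S μ * star (cuntzWord S ν)}).topologicalClosure

/-- `F_n`: the C*-subalgebra generated by all the words `S_μ S_ν*` with `|μ| = |ν|`. -/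
def cuntzFn {A : Type*} [CStarAlgebra A] {n : ℕ} (S : Fin n → A) : StarSubalgebra ℂ A :=
  (StarAlgebra.adjoin ℂ {x : A | ∃ μ ν : List (Fin n),
    μ.length = ν.length ∧ x = cuntzWord S μ * star (cuntzWord S ν)}).topologicalClosure

/-- A state on a C*-algebra: a positive continuous linear functional of norm one. -/
def IsState {A : Type*} [CStarAlgebra A] (f : A →L[ℂ] ℂ) : Prop :=
  ‖f‖ = 1 ∧ ∀ a : A, 0 ≤ f (star a * a)

/-- The defining property of the canonical state `φ_n` on `O_n`:
`φ_n(S_μ S_ν*) = n^{-|μ|} δ_{μν}`. -/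
def IsCuntzState {A : Type*} [CStarAlgebra A] {n : ℕ} (S : Fin n → A)
    (φ : A →L[ℂ] ℂ) : Prop :=
  IsState φ ∧ ∀ μ ν : List (Fin n),
    φ (cuntzWord S μ * star (cuntzWord S ν)) =
      if μ = ν then ((n : ℂ) ^ μ.length)⁻¹ else 0

section

variable {A : Type*} [CStarAlgebra A] {n : ℕ} {S : Fin n → A}

open Filter Topology

/-- The ranges of the generators of a Cuntz family are pairwise orthogonal. -/
lemma cuntz_star_mul (hiso : ∀ i, star (S i) * S i = 1) (hsum : ∑ i, S i * star (S i) = 1)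
    (i j : Fin n) : star (S i) * S j = if i = j then 1 else 0 := by
  split_ifs with hij
  · rw [hij, hiso]
  let _ : PartialOrder A := CStarAlgebra.spectralOrder A
  have _ : StarOrderedRing A := CStarAlgebra.spectralOrderedRing A
  have h1 : ∑ l, star (star (S l) * S j) * (star (S l) * S j) = 1 := by
    calc ∑ l, star (star (S l) * S j) * (star (S l) * S j)
        = star (S j) * (∑ l, S l * star (S l)) * S j := by
          simp only [Finset.mul_sum, Finset.sum_mul, star_mul, star_star, mul_assoc]
      _ = 1 := by rw [hsum, mul_one, hiso]
  rw [← Finset.add_sum_erase _ _ (Finset.mem_univ j)] at h1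
  have h2 : ∑ l ∈ Finset.univ.erase j, star (star (S l) * S j) * (star (S l) * S j) = 0 := by
    rwa [hiso, star_one, mul_one, add_eq_left] at h1
  rw [Finset.sum_eq_zero_iff_of_nonneg fun l _ ↦ star_mul_self_nonneg _] at h2
  exact (CStarRing.star_mul_self_eq_zero_iff _).mp (h2 i (by simp [hij]))

lemma cuntzWord_cons (i : Fin n) (μ : List (Fin n)) :
    cuntzWord S (i :: μ) = S i * cuntzWord S μ := by
  simp [cuntzWord]

lemma cuntzWord_concat (i : Fin n) (μ : List (Fin n)) :
    cuntzWord S (μ ++ [i]) = cuntzWord S μ * S i := by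
  simp [cuntzWord]

lemma cuntzWord_nil : cuntzWord S [] = 1 := rfl

lemma norm_le_one_of_star_mul_self {a : A} (h : star a * a = 1) : ‖a‖ ≤ 1 := by
  rcases subsingleton_or_nontrivial A with _ | _
  · simp [Subsingleton.elim a 0]
  · have h2 := CStarRing.norm_star_mul_self (x := a)
    rw [h, CStarRing.norm_one] at h2
    nlinarith [norm_nonneg a]

lemma star_cuntzWord_mul_self (hiso : ∀ i, star (S i) * S i = 1) (μ : List (Fin n)) :
    star (cuntzWord S μ) * cuntzWord S μ = 1 := by
  induction μ with
  | nil => simp [cuntzWord_nil]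
  | cons i μ ih =>
    rw [cuntzWord_cons, star_mul, mul_assoc, ← mul_assoc (star (S i)), hiso, one_mul, ih]

/-- The canonical endomorphism `x ↦ ∑ i, S i x (S i)*` of a Cuntz algebra. -/
noncomputable def cuntzEndomorphism (S : Fin n → A) (hiso : ∀ i, star (S i) * S i = 1)
    (hsum : ∑ i, S i * star (S i) = 1) : A →⋆ₐ[ℂ] A where
  toFun x := ∑ i, S i * x * star (S i)
  map_one' := by simpa using hsum
  map_mul' x y := by
    have key (i j : Fin n) : S i * x * star (S i) * (S j * y * star (S j)) =
        if i = j then S i * (x * y) * star (S j) else 0 := by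
      calc _ = S i * x * (star (S i) * S j) * y * star (S j) := by simp only [mul_assoc]
        _ = _ := by rw [cuntz_star_mul hiso hsum]; split_ifs <;> simp [mul_assoc]
    simp [Finset.sum_mul_sum, key]
  map_zero' := by simp
  map_add' x y := by simp [mul_add, add_mul, Finset.sum_add_distrib]
  commutes' r := by
    simp [Algebra.algebraMap_eq_smul_one, ← Finset.smul_sum, hsum]
  map_star' x := by simp [star_sum, mul_assoc]

lemma cuntzEndomorphism_apply (hiso : ∀ i, star (S i) * S i = 1)
    (hsum : ∑ i, S i * star (S i) = 1) (x : A) :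
    cuntzEndomorphism S hiso hsum x = ∑ i, S i * x * star (S i) := rfl

lemma cuntzWord_mul_star_mem_cuntzFn {μ ν : List (Fin n)} (h : μ.length = ν.length) :
    cuntzWord S μ * star (cuntzWord S ν) ∈ cuntzFn S :=
  StarSubalgebra.le_topologicalClosure _ (StarAlgebra.subset_adjoin ℂ _ ⟨μ, ν, h, rfl⟩)

lemma cuntzEndomorphism_mem_cuntzFn (hiso : ∀ i, star (S i) * S i = 1)
    (hsum : ∑ i, S i * star (S i) = 1) {x : A} (hx : x ∈ cuntzFn S) :
    cuntzEndomorphism S hiso hsum x ∈ cuntzFn S := by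
  have hcont : Continuous (cuntzEndomorphism S hiso hsum) := by
    simp only [funext (cuntzEndomorphism_apply hiso hsum)]
    fun_prop
  have hle : cuntzFn S ≤ (cuntzFn S).comap (cuntzEndomorphism S hiso hsum) := by
    refine StarSubalgebra.topologicalClosure_minimal (StarAlgebra.adjoin_le ?_)
      ((StarSubalgebra.isClosed_topologicalClosure _).preimage hcont)
    rintro _ ⟨μ, ν, h, rfl⟩
    change cuntzEndomorphism S hiso hsum _ ∈ cuntzFn S
    rw [cuntzEndomorphism_apply]
    refine sum_mem fun i _ ↦ ?_
    have := cuntzWord_mul_star_mem_cuntzFn (S := S) (μ := i :: μ) (ν := i :: ν) (by simp [h])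
    simpa only [cuntzWord_cons, star_mul, mul_assoc] using this
  exact hle hx

/-- The transfer operator `x ↦ n⁻¹ ∑ i, (S i)* x S i`, a left inverse of the canonical
endomorphism. -/
noncomputable def cuntzTransfer (S : Fin n → A) : A →L[ℂ] A :=
  (n : ℂ)⁻¹ • ∑ i, ContinuousLinearMap.mulLeftRight ℂ A (star (S i)) (S i)

lemma cuntzTransfer_apply (x : A) :
    cuntzTransfer S x = (n : ℂ)⁻¹ • ∑ i, star (S i) * x * S i := by
  simp [cuntzTransfer]

lemma cuntzTransfer_star (x : A) : cuntzTransfer S (star x) = star (cuntzTransfer S x) := by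
  simp [cuntzTransfer_apply, star_sum, mul_assoc]

lemma cuntzTransfer_pow_star (N : ℕ) (x : A) :
    (cuntzTransfer S ^ N) (star x) = star ((cuntzTransfer S ^ N) x) := by
  induction N with
  | zero => simp
  | succ N ih => simp [pow_succ', ih, cuntzTransfer_star]

lemma norm_cuntzTransfer_apply_le (hn : n ≠ 0) (hiso : ∀ i, star (S i) * S i = 1) (x : A) :
    ‖cuntzTransfer S x‖ ≤ ‖x‖ := by
  have hle (i : Fin n) : ‖star (S i) * x * S i‖ ≤ ‖x‖ := by
    have h1 := norm_le_one_of_star_mul_self (hiso i)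
    calc ‖star (S i) * x * S i‖ ≤ ‖star (S i)‖ * ‖x‖ * ‖S i‖ := norm_mul₃_le
      _ ≤ 1 * ‖x‖ * 1 := by rw [norm_star]; gcongr
      _ = ‖x‖ := by ring
  calc ‖cuntzTransfer S x‖ ≤ (n : ℝ)⁻¹ * ∑ i : Fin n, ‖x‖ := by
        rw [cuntzTransfer_apply, norm_smul, norm_inv, Complex.norm_natCast]
        gcongr
        exact norm_sum_le_of_le _ fun i _ ↦ hle i
    _ = ‖x‖ := by simp [hn]

lemma norm_cuntzTransfer_pow_apply_le (hn : n ≠ 0) (hiso : ∀ i, star (S i) * S i = 1) (N : ℕ)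
    (x : A) : ‖(cuntzTransfer S ^ N) x‖ ≤ ‖x‖ := by
  induction N with
  | zero => simp
  | succ N ih =>
    rw [pow_succ', mul_apply_eq_comp]
    exact (norm_cuntzTransfer_apply_le hn hiso _).trans ih

lemma cuntzTransfer_one (hn : n ≠ 0) (hiso : ∀ i, star (S i) * S i = 1) :
    cuntzTransfer S 1 = 1 := by
  simp [cuntzTransfer_apply, hiso, ← Nat.cast_smul_eq_nsmul ℂ, smul_smul, hn]

lemma cuntzTransfer_pow_one (hn : n ≠ 0) (hiso : ∀ i, star (S i) * S i = 1) (N : ℕ) :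
    (cuntzTransfer S ^ N) 1 = 1 := by
  induction N with
  | zero => simp
  | succ N ih => simp [pow_succ', ih, cuntzTransfer_one hn hiso]

lemma cuntzTransfer_cons_cons (hiso : ∀ i, star (S i) * S i = 1)
    (hsum : ∑ i, S i * star (S i) = 1) (i j : Fin n) (μ ν : List (Fin n)) :
    cuntzTransfer S (cuntzWord S (i :: μ) * star (cuntzWord S (j :: ν))) =
      (if i = j then (n : ℂ)⁻¹ else 0) • (cuntzWord S μ * star (cuntzWord S ν)) := by
  have key (l : Fin n) :
      star (S l) * (cuntzWord S (i :: μ) * star (cuntzWord S (j :: ν))) * S l =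
        if l = i then (if j = i then cuntzWord S μ * star (cuntzWord S ν) else 0) else 0 := by
    calc _ = (star (S l) * S i) * (cuntzWord S μ * star (cuntzWord S ν)) * (star (S j) * S l) := by
          simp only [cuntzWord_cons, star_mul, mul_assoc]
      _ = _ := by
        rw [cuntz_star_mul hiso hsum, cuntz_star_mul hiso hsum]
        split_ifs <;> simp_all
  rw [cuntzTransfer_apply]
  simp only [key, Finset.sum_ite_eq', Finset.mem_univ, if_true, eq_comm (a := j)]
  split_ifs <;> simp

lemma cuntzTransfer_cons (hiso : ∀ i, star (S i) * S i = 1)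
    (hsum : ∑ i, S i * star (S i) = 1) (i : Fin n) (μ : List (Fin n)) :
    cuntzTransfer S (cuntzWord S (i :: μ)) = (n : ℂ)⁻¹ • cuntzWord S (μ ++ [i]) := by
  have key (l : Fin n) : star (S l) * cuntzWord S (i :: μ) * S l =
      if l = i then cuntzWord S (μ ++ [i]) else 0 := by
    rw [cuntzWord_cons, ← mul_assoc, cuntz_star_mul hiso hsum]
    split_ifs with h
    · rw [h, one_mul, cuntzWord_concat]
    · simp
  rw [cuntzTransfer_apply]
  simp [key]

lemma norm_cuntzTransfer_pow_cuntzWord_le (hiso : ∀ i, star (S i) * S i = 1)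
    (hsum : ∑ i, S i * star (S i) = 1) (N : ℕ) {μ : List (Fin n)} (hμ : μ ≠ []) :
    ‖(cuntzTransfer S ^ N) (cuntzWord S μ)‖ ≤ ((n : ℝ)⁻¹) ^ N := by
  induction N generalizing μ with
  | zero => simpa using norm_le_one_of_star_mul_self (star_cuntzWord_mul_self hiso μ)
  | succ N ih =>
    obtain ⟨i, μ, rfl⟩ := List.exists_cons_of_ne_nil hμ
    rw [pow_succ, mul_apply_eq_comp, cuntzTransfer_cons hiso hsum, map_smul,
      norm_smul, norm_inv, Complex.norm_natCast, pow_succ']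
    gcongr
    exact ih (by simp)

lemma tendsto_cuntzTransfer_pow_cuntzWord (hn : 2 ≤ n) (hiso : ∀ i, star (S i) * S i = 1)
    (hsum : ∑ i, S i * star (S i) = 1) {μ : List (Fin n)} (hμ : μ ≠ []) :
    Tendsto (fun N ↦ (cuntzTransfer S ^ N) (cuntzWord S μ)) atTop (𝓝 0) := by
  refine squeeze_zero_norm
    (fun N ↦ norm_cuntzTransfer_pow_cuntzWord_le hiso hsum N hμ)
    (tendsto_pow_atTop_nhds_zero_of_lt_one (by positivity) (inv_lt_one_of_one_lt₀ ?_))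
  exact_mod_cast hn

lemma tendsto_cuntzTransfer_pow_word (hn : 2 ≤ n) (hiso : ∀ i, star (S i) * S i = 1)
    (hsum : ∑ i, S i * star (S i) = 1) {φ : A →L[ℂ] ℂ} (hφ : IsCuntzState S φ)
    (μ ν : List (Fin n)) :
    Tendsto (fun N ↦ (cuntzTransfer S ^ N) (cuntzWord S μ * star (cuntzWord S ν))) atTop
      (𝓝 (φ (cuntzWord S μ * star (cuntzWord S ν)) • (1 : A))) := by
  induction μ generalizing ν with
  | nil =>
    rcases ν with _ | ⟨j, ν⟩
    · rw [hφ.2]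
      simp [-FunLike.coe_pow_eq_iterate, cuntzWord_nil, cuntzTransfer_pow_one (by omega) hiso]
    · have := (tendsto_cuntzTransfer_pow_cuntzWord hn hiso hsum (List.cons_ne_nil j ν)).star
      rw [hφ.2]
      simpa only [cuntzWord_nil, one_mul, cuntzTransfer_pow_star, star_zero, zero_smul,
        List.nil_eq, reduceCtorEq, if_false] using this
  | cons i μ ih =>
    rcases ν with _ | ⟨j, ν⟩
    · have := tendsto_cuntzTransfer_pow_cuntzWord hn hiso hsum (List.cons_ne_nil i μ)
      rw [hφ.2]
      simpa [cuntzWord_nil] using this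
    · rw [← tendsto_add_atTop_iff_nat 1]
      have := (ih ν).const_smul (if i = j then (n : ℂ)⁻¹ else 0)
      simp only [pow_succ, mul_apply_eq_comp, cuntzTransfer_cons_cons hiso hsum,
        map_smul]
      convert this using 2
      rw [hφ.2, hφ.2, smul_smul]
      congr 1
      by_cases hij : i = j <;> by_cases hμ : μ = ν <;> simp [hij, hμ, pow_succ', mul_comm]

/-- The *-algebra generated by a Cuntz family is spanned by the elements `S_μ S_ν*`. -/
lemma cuntz_adjoin_le_span (hiso : ∀ i, star (S i) * S i = 1)
    (hsum : ∑ i, S i * star (S i) = 1) {a : A} (ha : a ∈ StarAlgebra.adjoin ℂ (Set.range S)) :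
    a ∈ Submodule.span ℂ
      (Set.range fun p : List (Fin n) × List (Fin n) ↦
        cuntzWord S p.1 * star (cuntzWord S p.2)) := by
  set W := Submodule.span ℂ (Set.range fun p : List (Fin n) × List (Fin n) ↦
        cuntzWord S p.1 * star (cuntzWord S p.2))
  have hword (μ ν : List (Fin n)) : cuntzWord S μ * star (cuntzWord S ν) ∈ W :=
    Submodule.subset_span ⟨(μ, ν), rfl⟩
  have hmul {b : A} (hb : ∀ μ ν, b * (cuntzWord S μ * star (cuntzWord S ν)) ∈ W) {w : A}
      (hw : w ∈ W) : b * w ∈ W := by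
    have : W ≤ W.comap (LinearMap.mulLeft ℂ b) := by
      refine Submodule.span_le.mpr ?_
      rintro _ ⟨⟨μ, ν⟩, rfl⟩
      exact hb μ ν
    exact this hw
  suffices h : ∀ w ∈ W, a * w ∈ W by
    simpa [cuntzWord_nil] using h _ (hword [] [])
  rw [← StarSubalgebra.mem_toSubalgebra, StarAlgebra.adjoin_toSubalgebra] at ha
  induction ha using Algebra.adjoin_induction with
  | mem b hb =>
    refine fun w hw ↦ hmul (fun μ ν ↦ ?_) hw
    rcases hb with ⟨i, rfl⟩ | ⟨i, hi⟩
    · rw [← mul_assoc, ← cuntzWord_cons]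
      exact hword _ _
    · obtain rfl : b = star (S i) := by rw [hi, star_star]
      rcases μ with _ | ⟨j, μ⟩
      · rw [cuntzWord_nil, one_mul, ← star_mul, ← cuntzWord_concat]
        simpa [cuntzWord_nil] using hword [] (ν ++ [i])
      · rw [cuntzWord_cons, mul_assoc, ← mul_assoc, cuntz_star_mul hiso hsum]
        split_ifs
        · simpa using hword μ ν
        · simp
  | algebraMap r =>
    intro w hw
    rw [← Algebra.smul_def]
    exact W.smul_mem r hw
  | add b c _ _ hb hc =>
    intro w hw
    rw [add_mul]
    exact W.add_mem (hb w hw) (hc w hw)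
  | mul b c _ _ hb hc =>
    intro w hw
    rw [mul_assoc]
    exact hb _ (hc w hw)

lemma tendsto_cuntzTransfer_pow (hn : 2 ≤ n) (hiso : ∀ i, star (S i) * S i = 1)
    (hsum : ∑ i, S i * star (S i) = 1)
    (hgen : (StarAlgebra.adjoin ℂ (Set.range S)).topologicalClosure = ⊤)
    {φ : A →L[ℂ] ℂ} (hφ : IsCuntzState S φ) (x : A) :
    Tendsto (fun N ↦ (cuntzTransfer S ^ N) x) atTop (𝓝 (φ x • (1 : A))) := by
  have hspan {a : A} (ha : a ∈ StarAlgebra.adjoin ℂ (Set.range S)) :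
      Tendsto (fun N ↦ (cuntzTransfer S ^ N) a) atTop (𝓝 (φ a • (1 : A))) := by
    have h := cuntz_adjoin_le_span hiso hsum ha
    clear ha
    induction h using Submodule.span_induction with
    | mem _ h =>
      obtain ⟨p, rfl⟩ := h
      exact tendsto_cuntzTransfer_pow_word hn hiso hsum hφ p.1 p.2
    | zero => simp
    | add b c _ _ hb hc => simpa [add_smul] using hb.add hc
    | smul r b _ hb => simpa [mul_smul] using hb.const_smul r
  have hx : x ∈ closure (StarAlgebra.adjoin ℂ (Set.range S) : Set A) := by
    rw [← StarSubalgebra.topologicalClosure_coe, hgen]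
    exact Set.mem_univ x
  rw [Metric.tendsto_atTop]
  intro ε hε
  have hC : 0 < 1 + ‖φ‖ * ‖(1 : A)‖ := by positivity
  obtain ⟨a, ha, hxa⟩ := Metric.mem_closure_iff.mp hx (ε / 2 / (1 + ‖φ‖ * ‖(1 : A)‖))
    (by positivity)
  obtain ⟨N₀, hN₀⟩ := Metric.tendsto_atTop.mp (hspan ha) (ε / 2) (by positivity)
  refine ⟨N₀, fun N hN ↦ ?_⟩
  have h1 := hN₀ N hN
  rw [dist_eq_norm] at h1 hxa ⊢
  rw [lt_div_iff₀ hC] at hxa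
  have h2 : (cuntzTransfer S ^ N) x - φ x • (1 : A) = (cuntzTransfer S ^ N) (x - a) +
      ((cuntzTransfer S ^ N) a - φ a • (1 : A)) - φ (x - a) • (1 : A) := by
    simp only [map_sub, sub_smul]
    abel
  have h3 : ‖φ (x - a) • (1 : A)‖ ≤ ‖φ‖ * ‖x - a‖ * ‖(1 : A)‖ := by
    rw [norm_smul]
    gcongr
    exact φ.le_opNorm _
  have h4 := norm_cuntzTransfer_pow_apply_le (by omega) hiso N (x - a)
  rw [h2]
  refine (norm_sub_le _ _).trans_lt ?_
  have h5 := norm_add_le ((cuntzTransfer S ^ N) (x - a))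
    ((cuntzTransfer S ^ N) a - φ a • (1 : A))
  nlinarith

/-- A finite convex combination of the maps `ad(u)`, with `u` a unitary in `F_n`. -/
def IsCuntzAveraging (S : Fin n → A) (α : A → A) : Prop :=
  ∃ (m : ℕ) (lam : Fin m → ℝ) (u : Fin m → A),
    (∀ i, 0 ≤ lam i) ∧ (∑ i, lam i = 1) ∧
    (∀ i, u i ∈ cuntzFn S ∧ u i * star (u i) = 1 ∧ star (u i) * u i = 1) ∧
    ∀ x : A, α x = ∑ i, lam i • (u i * x * star (u i))

lemma IsCuntzAveraging.of_fintype {ι : Type*} [Fintype ι] {α : A → A} (lam : ι → ℝ) (u : ι → A)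
    (h0 : ∀ i, 0 ≤ lam i) (h1 : ∑ i, lam i = 1)
    (hu : ∀ i, u i ∈ cuntzFn S ∧ u i * star (u i) = 1 ∧ star (u i) * u i = 1)
    (hα : ∀ x, α x = ∑ i, lam i • (u i * x * star (u i))) : IsCuntzAveraging S α := by
  let e := (Fintype.equivFin ι).symm
  refine ⟨Fintype.card ι, lam ∘ e, u ∘ e, fun i ↦ h0 _, ?_, fun i ↦ hu _, fun x ↦ ?_⟩
  · rw [← h1]
    exact e.sum_comp lam
  · rw [hα]
    exact (e.sum_comp fun i ↦ lam i • (u i * x * star (u i))).symm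

lemma isCuntzAveraging_id : IsCuntzAveraging S id :=
  .of_fintype (fun _ : Unit ↦ 1) (fun _ ↦ 1) (by simp) (by simp) (by simp [one_mem]) (by simp)

lemma IsCuntzAveraging.comp {α β : A → A} (hα : IsCuntzAveraging S α)
    (hβ : IsCuntzAveraging S β) : IsCuntzAveraging S (α ∘ β) := by
  obtain ⟨m, lam, u, h0, h1, hu, hα⟩ := hα
  obtain ⟨m', lam', u', h0', h1', hu', hβ⟩ := hβ
  refine .of_fintype (fun p : Fin m × Fin m' ↦ lam p.1 * lam' p.2) (fun p ↦ u p.1 * u' p.2)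
    (fun p ↦ mul_nonneg (h0 _) (h0' _)) ?_ (fun p ↦ ⟨mul_mem (hu _).1 (hu' _).1, ?_, ?_⟩)
    fun x ↦ ?_
  · rw [Fintype.sum_prod_type, ← Finset.sum_mul_sum, h1, h1', mul_one]
  · rw [star_mul, mul_assoc, ← mul_assoc (u' _), (hu' _).2.1, one_mul, (hu _).2.1]
  · rw [star_mul, mul_assoc, ← mul_assoc (star (u _)), (hu _).2.2, one_mul, (hu' _).2.2]
  · simp only [Function.comp_apply, hα, hβ, Fintype.sum_prod_type, Finset.mul_sum,
      Finset.sum_mul, Finset.smul_sum, mul_smul, star_mul, mul_assoc, mul_smul_comm,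
      smul_mul_assoc]

/-- The composition of the canonical endomorphism with the transfer operator averages over the
unitaries `∑ i, ψ (k i) S_{i + j} (S_i)*`, where `ψ` is a primitive character of `ℤ / n`. -/
lemma isCuntzAveraging_cuntzEndomorphism_cuntzTransfer (hn : n ≠ 0)
    (hiso : ∀ i, star (S i) * S i = 1) (hsum : ∑ i, S i * star (S i) = 1) :
    IsCuntzAveraging S fun x ↦ cuntzEndomorphism S hiso hsum (cuntzTransfer S x) := by
  obtain ⟨m, rfl⟩ := Nat.exists_eq_succ_of_ne_zero hn
  let _ : CommRing (Fin (m + 1)) := inferInstanceAs (CommRing (ZMod (m + 1)))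
  obtain ⟨ψ, hψ⟩ : ∃ ψ : AddChar (Fin (m + 1)) ℂ, ψ.IsPrimitive :=
    ⟨ZMod.stdAddChar (N := m + 1), ZMod.isPrimitive_stdAddChar (m + 1)⟩
  have hstar (i : Fin (m + 1)) : star (ψ i) = ψ (-i) := (AddChar.map_neg_eq_conj ψ i).symm
  let u (p : Fin (m + 1) × Fin (m + 1)) : A := ∑ i, ψ (p.2 * i) • (S (i + p.1) * star (S i))
  have hu_star (p) : star (u p) = ∑ i, ψ (-(p.2 * i)) • (S i * star (S (i + p.1))) := by
    simp [u, star_sum, ← hstar]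
  have hconj (p) (x : A) : u p * x * star (u p) = ∑ i, ∑ l, ψ (p.2 * (i - l)) •
      (S (i + p.1) * (star (S i) * x * S l) * star (S (l + p.1))) := by
    rw [hu_star]
    simp only [u, Finset.sum_mul, Finset.mul_sum]
    rw [Finset.sum_comm]
    refine Finset.sum_congr rfl fun i _ ↦ Finset.sum_congr rfl fun l _ ↦ ?_
    rw [mul_sub, sub_eq_add_neg, AddChar.map_add_eq_mul]
    simp only [smul_mul_assoc, mul_smul_comm, smul_smul, mul_assoc]
    rw [mul_comm]
  have hshift (j : Fin (m + 1)) (f : Fin (m + 1) → A) : ∑ i, f (i + j) = ∑ i, f i :=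
    Equiv.sum_comp (Equiv.addRight j) f
  have huu (p) : u p * star (u p) = 1 := by
    have := hconj p 1
    simp only [mul_one] at this
    rw [this]
    simp only [cuntz_star_mul hiso hsum]
    simp [mul_ite, ite_mul, hshift p.1 fun i ↦ S i * star (S i), hsum]
  have huu' (p) : star (u p) * u p = 1 := by
    rw [hu_star]
    simp only [u, Finset.sum_mul_sum]
    have (i l : Fin (m + 1)) : (ψ (-(p.2 * i)) • (S i * star (S (i + p.1)))) *
        (ψ (p.2 * l) • (S (l + p.1) * star (S l))) =
        if i = l then S i * star (S l) else 0 := by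
      calc _ = (ψ (-(p.2 * i)) * ψ (p.2 * l)) •
            (S i * (star (S (i + p.1)) * S (l + p.1)) * star (S l)) := by
            simp only [smul_mul_assoc, mul_smul_comm, smul_smul, mul_assoc]
            rw [mul_comm]
        _ = _ := by
          rw [cuntz_star_mul hiso hsum, ← AddChar.map_add_eq_mul]
          by_cases h : i = l <;> simp [h]
    simp [this, hsum]
  refine .of_fintype (fun _ ↦ ((m + 1 : ℕ) : ℝ)⁻¹ * ((m + 1 : ℕ) : ℝ)⁻¹) u
    (fun _ ↦ by positivity) ?_ (fun p ↦ ⟨?_, huu p, huu' p⟩) fun x ↦ ?_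
  · simp
    field_simp
  · refine sum_mem fun i _ ↦ SMulMemClass.smul_mem _ ?_
    simpa [cuntzWord] using
      cuntzWord_mul_star_mem_cuntzFn (S := S) (μ := [i + p.1]) (ν := [i]) rfl
  · have hsumk (j : Fin (m + 1)) : ∑ k, u (j, k) * x * star (u (j, k)) =
        ((m + 1 : ℕ) : ℂ) • ∑ i, S (i + j) * (star (S i) * x * S i) * star (S (i + j)) := by
      simp only [hconj]
      rw [Finset.sum_comm, Finset.smul_sum]
      refine Finset.sum_congr rfl fun i _ ↦ ?_
      rw [Finset.sum_comm]
      simp only [← Finset.sum_smul, AddChar.sum_mulShift _ hψ, sub_eq_zero]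
      simp
    have hsumj : ∑ j, ∑ i, S (i + j) * (star (S i) * x * S i) * star (S (i + j)) =
        ∑ j, S j * (∑ i, star (S i) * x * S i) * star (S j) := by
      simp only [Finset.mul_sum, Finset.sum_mul]
      refine Finset.sum_comm.trans (Eq.trans ?_ Finset.sum_comm)
      exact Finset.sum_congr rfl fun i _ ↦
        Equiv.sum_comp (Equiv.addLeft i) fun j ↦ S j * (star (S i) * x * S i) * star (S j)
    rw [cuntzEndomorphism_apply, cuntzTransfer_apply, ← Finset.smul_sum, Fintype.sum_prod_type]
    simp only [hsumk]
    rw [← Finset.smul_sum, hsumj, ← Complex.coe_smul, smul_smul]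
    simp only [mul_smul_comm, smul_mul_assoc, ← Finset.smul_sum]
    congr 1
    push_cast
    field_simp

lemma isCuntzAveraging_pow (hn : n ≠ 0) (hiso : ∀ i, star (S i) * S i = 1)
    (hsum : ∑ i, S i * star (S i) = 1) (N : ℕ) :
    IsCuntzAveraging S fun x ↦
      (cuntzEndomorphism S hiso hsum ^ N) ((cuntzTransfer S ^ N) x) := by
  induction N with
  | zero => exact isCuntzAveraging_id
  | succ N ih =>
    obtain ⟨m, lam, u, h0, h1, hu, hα⟩ := ih
    let β (x : A) : A := ∑ i, lam i • (cuntzEndomorphism S hiso hsum (u i) * x *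
      star (cuntzEndomorphism S hiso hsum (u i)))
    have hβ : IsCuntzAveraging S β :=
      ⟨m, lam, fun i ↦ cuntzEndomorphism S hiso hsum (u i), h0, h1, fun i ↦
        ⟨cuntzEndomorphism_mem_cuntzFn hiso hsum (hu i).1,
          by rw [← map_star, ← map_mul, (hu i).2.1, map_one],
          by rw [← map_star, ← map_mul, (hu i).2.2, map_one]⟩, fun x ↦ rfl⟩
    convert hβ.comp (isCuntzAveraging_cuntzEndomorphism_cuntzTransfer hn hiso hsum) using 1
    funext x
    have := hα (cuntzTransfer S x)
    simp only [pow_succ' (cuntzEndomorphism S hiso hsum), pow_succ (cuntzTransfer S),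
      mul_apply_eq_comp, Function.comp_apply, β]
    refine (congrArg (cuntzEndomorphism S hiso hsum) this).trans ?_
    rw [map_sum]
    simp only [← Complex.coe_smul, map_smul, map_mul, map_star]

lemma tendsto_cuntzEndomorphism_pow_cuntzTransfer_pow (hn : 2 ≤ n)
    (hiso : ∀ i, star (S i) * S i = 1) (hsum : ∑ i, S i * star (S i) = 1)
    (hgen : (StarAlgebra.adjoin ℂ (Set.range S)).topologicalClosure = ⊤)
    {φ : A →L[ℂ] ℂ} (hφ : IsCuntzState S φ) (x : A) :
    Tendsto (fun N ↦ ‖(cuntzEndomorphism S hiso hsum ^ N) ((cuntzTransfer S ^ N) x) -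
      φ x • (1 : A)‖) atTop (𝓝 0) := by
  refine squeeze_zero (fun _ ↦ norm_nonneg _) (fun N ↦ ?_)
    (tendsto_iff_norm_sub_tendsto_zero.mp (tendsto_cuntzTransfer_pow hn hiso hsum hgen hφ x))
  have h : (cuntzEndomorphism S hiso hsum ^ N) ((cuntzTransfer S ^ N) x) - φ x • (1 : A) =
      (cuntzEndomorphism S hiso hsum ^ N) ((cuntzTransfer S ^ N) x - φ x • 1) := by
    rw [map_sub, map_smul, map_one]
  rw [h]
  exact NonUnitalStarAlgHom.norm_apply_le (cuntzEndomorphism S hiso hsum ^ N) _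

end

/-- Dixmier-type averaging for finite subsets of `O_n`: a single convex combination of maps
`ad(u) : x ↦ u x u*`, with `u` unitary in `F_n`, simultaneously brings finitely many elements
`ε`-close to `φ_n(x)·1`; consequently there is a net of such convex combinations converging
to `φ_n(x)·1` in norm for every `x ∈ O_n`. -/
theorem cuntz_dixmier_property_finite_sets {A : Type*} [CStarAlgebra A] {n : ℕ} (hn : 2 ≤ n)
    (S : Fin n → A)
    (hiso : ∀ i, star (S i) * S i = 1)
    (hsum : ∑ i, S i * star (S i) = 1)
    (hgen : (StarAlgebra.adjoin ℂ (Set.range S)).topologicalClosure = ⊤)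
    (φ : A →L[ℂ] ℂ) (hφ : IsCuntzState S φ) :
    (∀ (k : ℕ) (x : Fin k → A) (ε : ℝ), 0 < ε →
      ∃ (m : ℕ) (lam : Fin m → ℝ) (u : Fin m → A),
        (∀ i, 0 ≤ lam i) ∧ (∑ i, lam i = 1) ∧
        (∀ i, u i ∈ cuntzFn S ∧ u i * star (u i) = 1 ∧ star (u i) * u i = 1) ∧
        ∀ j : Fin k, ‖(∑ i, lam i • (u i * x j * star (u i))) - φ (x j) • (1 : A)‖ < ε) ∧
    (∃ (J : Type) (_ : Preorder J) (_ : IsDirected J (· ≤ ·)) (_ : Nonempty J)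
        (α : J → A → A),
      (∀ j : J, ∃ (m : ℕ) (lam : Fin m → ℝ) (u : Fin m → A),
        (∀ i, 0 ≤ lam i) ∧ (∑ i, lam i = 1) ∧
        (∀ i, u i ∈ cuntzFn S ∧ u i * star (u i) = 1 ∧ star (u i) * u i = 1) ∧
        ∀ x : A, α j x = ∑ i, lam i • (u i * x * star (u i))) ∧
      ∀ x : A, Filter.Tendsto (fun j : J => ‖α j x - φ x • (1 : A)‖)
        Filter.atTop (nhds 0)) := by
  have hlim := tendsto_cuntzEndomorphism_pow_cuntzTransfer_pow hn hiso hsum hgen hφ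
  have havg := isCuntzAveraging_pow (by omega) hiso hsum
  refine ⟨fun k x ε hε ↦ ?_, ℕ, inferInstance, inferInstance, inferInstance, _, havg, hlim⟩
  obtain ⟨N, hN⟩ :=
    (Filter.eventually_all.mpr fun j ↦ (hlim (x j)).eventually_lt_const hε).exists
  obtain ⟨m, lam, u, h0, h1, hu, hα⟩ := havg N
  exact ⟨m, lam, u, h0, h1, hu, fun j ↦ hα (x j) ▸ hN j⟩
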